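/- arXiv:1412.8259 — 2 statements merged into one kernel-verified Lean document; each statement's English description precedes it below -/
import Mathlib

section
/- For every integer m ≥ 0, the Bernoulli numbers satisfy B_m = ∑_{n=0}^m s₂(m,n) · D_n. -/
/-- The Daehee numbers `D_n = (-1)^n * n! / (n+1)`. -/
noncomputable def daehee (n : ℕ) : ℝ := (-1) ^ n * (n.factorial : ℝ) / (n + 1)

/-- The Stirling numbers of the second kind, defined by the recurrence
`s₂(m+1, n+1) = (n+1) s₂(m, n+1) + s₂(m, n)`; equivalently
`x^m = ∑_{n=0}^m s₂(m,n) x(x-1)⋯(x-n+1)`. -/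
noncomputable def s2 : ℕ → ℕ → ℝ
  | 0, 0 => 1
  | 0, _ + 1 => 0
  | _ + 1, 0 => 0
  | m + 1, n + 1 => (n + 1 : ℝ) * s2 m (n + 1) + s2 m n

theorem s2_eq_zero : ∀ (m n : ℕ), m < n → s2 m n = 0
  | 0, 0, h => by omega
  | 0, n + 1, _ => by simp [s2]
  | m + 1, 0, h => by omega
  | m + 1, n + 1, h => by
    simp [s2, s2_eq_zero m (n + 1) (by omega), s2_eq_zero m n (by omega)]

open Polynomial in
theorem pow_eq_s2 (x : ℝ) (m : ℕ) :
    x ^ m = ∑ n ∈ Finset.range (m + 1), s2 m n * (descPochhammer ℝ n).eval x := by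
  induction m with
  | zero => simp [s2]
  | succ m ih =>
    rw [Finset.sum_range_succ']
    have h1 : ∀ n, s2 (m + 1) (n + 1) * (descPochhammer ℝ (n + 1)).eval x
        = (((n + 1 : ℕ) : ℝ) * s2 m (n + 1) * (descPochhammer ℝ (n + 1)).eval x)
          + s2 m n * ((descPochhammer ℝ n).eval x * (x - n)) := by
      intro n
      have : (descPochhammer ℝ (n + 1)).eval x = (descPochhammer ℝ n).eval x * (x - n) := by
        simp [descPochhammer_succ_right]
      rw [s2, this]; push_cast; ring
    rw [Finset.sum_congr rfl (fun n _ => h1 n), Finset.sum_add_distrib]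
    have h2 := Finset.sum_range_succ'
      (fun n : ℕ => (n : ℝ) * s2 m n * (descPochhammer ℝ n).eval x) (m + 1)
    rw [Finset.sum_range_succ, s2_eq_zero m (m + 1) (by omega)] at h2
    simp only [Nat.cast_zero, zero_mul, mul_zero, add_zero] at h2
    rw [← h2, ← Finset.sum_add_distrib, pow_succ, ih, Finset.sum_mul]
    simp only [s2, zero_mul, add_zero]
    refine Finset.sum_congr rfl fun n _ => ?_
    ring

open Polynomial in
theorem sum_desc (n N : ℕ) :
    ∑ k ∈ Finset.range N, (descPochhammer ℝ n).eval (k : ℝ)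
      = (descPochhammer ℝ (n + 1)).eval (N : ℝ) / (n + 1) := by
  have hn : (n + 1 : ℝ) ≠ 0 := by positivity
  induction N with
  | zero => simp [descPochhammer_succ_left]
  | succ N ih =>
    rw [Finset.sum_range_succ, ih]
    have h1 : (descPochhammer ℝ (n + 1)).eval (N : ℝ)
        = (descPochhammer ℝ n).eval (N : ℝ) * (N - n) := by
      simp [descPochhammer_succ_right]
    have h2 : (descPochhammer ℝ (n + 1)).eval ((N + 1 : ℕ) : ℝ)
        = (N + 1) * (descPochhammer ℝ n).eval (N : ℝ) := by
      simp [descPochhammer_succ_left]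
    rw [h1, h2]; field_simp; ring

open Polynomial in
theorem desc_neg_one (n : ℕ) :
    (descPochhammer ℝ n).eval (-1) = (-1) ^ n * (n.factorial : ℝ) := by
  induction n with
  | zero => simp
  | succ n ih =>
    have h1 : (descPochhammer ℝ (n + 1)).eval (-1 : ℝ)
        = (descPochhammer ℝ n).eval (-1) * (-1 - n) := by
      simp [descPochhammer_succ_right]
    rw [h1, ih, Nat.factorial_succ]; push_cast; ring

open Polynomial in
theorem desc_coeff_one (n : ℕ) :
    (descPochhammer ℝ (n + 1)).coeff 1 = (-1) ^ n * (n.factorial : ℝ) := by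
  rw [descPochhammer_succ_left, show (1 : ℕ) = 0 + 1 from rfl, coeff_X_mul,
    coeff_zero_eq_eval_zero, ← desc_neg_one]
  simp

open Polynomial in
theorem poly_eq (m : ℕ) :
    (∑ i ∈ Finset.range (m + 1),
      C ((bernoulli i : ℝ) * ((m + 1).choose i : ℝ) / (m + 1)) * X ^ (m + 1 - i))
    = ∑ n ∈ Finset.range (m + 1), C (s2 m n / (n + 1)) * descPochhammer ℝ (n + 1) := by
  apply Polynomial.eq_of_infinite_eval_eq
  apply (Set.infinite_range_of_injective (Nat.cast_injective (R := ℝ))).mono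
  rintro _ ⟨N, rfl⟩
  simp only [Set.mem_setOf_eq, eval_finset_sum, eval_mul, eval_C, eval_pow, eval_X]
  have h := congrArg (fun q : ℚ => (q : ℝ)) (sum_range_pow N m)
  push_cast at h
  calc _ = ∑ k ∈ Finset.range N, (k : ℝ) ^ m := by
        rw [h]; exact Finset.sum_congr rfl fun i _ => by ring
    _ = ∑ k ∈ Finset.range N, ∑ n ∈ Finset.range (m + 1),
          s2 m n * (descPochhammer ℝ n).eval (k : ℝ) :=
        Finset.sum_congr rfl fun k _ => pow_eq_s2 _ _
    _ = _ := by
        rw [Finset.sum_comm]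
        refine Finset.sum_congr rfl fun n _ => ?_
        rw [← Finset.mul_sum, sum_desc]; ring

theorem bernoulli_eq_sum_stirling2_daehee (m : ℕ) :
    (bernoulli m : ℝ) = ∑ n ∈ Finset.range (m + 1), s2 m n * daehee n := by
  have h := congrArg (fun p => Polynomial.coeff p 1) (poly_eq m)
  simp only [Polynomial.finset_sum_coeff, Polynomial.coeff_C_mul, desc_coeff_one,
    Polynomial.coeff_X_pow] at h
  rw [Finset.sum_range_succ, Finset.sum_eq_zero] at h
  · have hm : (m + 1 : ℝ) ≠ 0 := by positivity
    simp [hm] at h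
    rw [h]
    exact Finset.sum_congr rfl fun n _ => by rw [daehee]; ring
  · intro i hi
    have := Finset.mem_range.1 hi
    rw [if_neg (by omega), mul_zero]
end

section
/- Let λ be a positive integer. For every integer m ≥ 0 and every real number x, the λ-Daehee polynomial evaluated at λx satisfies D_{m,λ}(λx) = m! · ∑_{n=0}^m ∑_{(i_1,…,i_n)} (D_n(x)/n!) · C(λ,i_1)·C(λ,i_2)⋯C(λ,i_n), where the inner sum ranges over all n-tuples of positive integers (i_1,…,i_n) with i_1 + i_2 + ⋯ + i_n = m (for n = 0 the inner sum is nonempty only when m = 0, in which case the empty product equals 1). Note that D_{m,λ}(λx) = ∑_{l=0}^m s₁(m,l) · λ^l · B_l(x). -/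
/-- The falling factorial `x(x-1)⋯(x-m+1)` of a real number `x` (empty product is 1). -/
noncomputable def fallFac (x : ℝ) (m : ℕ) : ℝ := ∏ i ∈ Finset.range m, (x - i)

/-- The Daehee polynomials `D_n(x) = ∑_{m=0}^n C(n,m) D_{n-m} x(x-1)⋯(x-m+1)`. -/
noncomputable def daeheePoly (n : ℕ) (x : ℝ) : ℝ :=
  ∑ m ∈ Finset.range (n + 1), (n.choose m : ℝ) * daehee (n - m) * fallFac x m

/-- The signed Stirling numbers of the first kind, given as the coefficients of the
falling-factorial polynomial `X(X-1)⋯(X-n+1) = ∑_{l=0}^n s₁(n,l) X^l`. -/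
noncomputable def s1 (n l : ℕ) : ℝ := (descPochhammer ℝ n).coeff l

/-- The Bernoulli polynomial `B_n(x)` (with `B_1(0) = -1/2`), evaluated at a real `x`. -/
noncomputable def bernoulliPoly (n : ℕ) (x : ℝ) : ℝ := Polynomial.aeval x (Polynomial.bernoulli n)

open Polynomial in
lemma aux_coeff_pow (g : ℝ[X]) (n m : ℕ) :
    (g ^ n).coeff m = ∑ i ∈ Finset.Nat.antidiagonalTuple n m, ∏ j, g.coeff (i j) := by
  induction n generalizing m with
  | zero =>
    cases m with
    | zero => simp
    | succ m => simp [Polynomial.coeff_one]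
  | succ n ih =>
    rw [pow_succ', Polynomial.coeff_mul]
    simp_rw [ih, Finset.mul_sum]
    rw [Finset.sum_sigma']
    refine Finset.sum_bij' (fun a _ => Fin.cons a.1.1 a.2)
      (fun i _ => ⟨(i 0, ∑ j, Fin.tail i j), Fin.tail i⟩) ?_ ?_ ?_ ?_ ?_
    · rintro ⟨⟨a, b⟩, t⟩ h
      simp [Finset.Nat.mem_antidiagonalTuple, Fin.sum_univ_succ] at h ⊢
      omega
    · intro i h
      simp [Finset.Nat.mem_antidiagonalTuple, Fin.sum_univ_succ, Fin.tail] at h ⊢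
      omega
    · rintro ⟨⟨a, b⟩, t⟩ h
      simp [Finset.Nat.mem_antidiagonalTuple] at h ⊢
      exact h.2
    · intro i h
      simp
    · rintro ⟨⟨a, b⟩, t⟩ h
      simp [Fin.prod_univ_succ]

open Polynomial in
lemma aux_S (lam n m : ℕ) :
    (∑ i ∈ (Finset.Nat.antidiagonalTuple n m).filter (fun i => ∀ j, 0 < i j),
      ∏ j, (lam.choose (i j) : ℝ)) = (((1 + X : ℝ[X]) ^ lam - 1) ^ n).coeff m := by
  rw [aux_coeff_pow, Finset.sum_filter]
  refine Finset.sum_congr rfl fun i _ => ?_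
  split_ifs with h
  · refine Finset.prod_congr rfl fun j _ => ?_
    rw [coeff_sub, coeff_one_add_X_pow, coeff_one, if_neg (h j).ne', sub_zero]
  · push Not at h
    obtain ⟨j, hj⟩ := h
    symm
    apply Finset.prod_eq_zero (Finset.mem_univ j)
    have : i j = 0 := by omega
    rw [this, coeff_sub, coeff_one_add_X_pow]
    simp

open Polynomial in
lemma aux_S_zero (lam n m : ℕ) (h : m < n) : (((1 + X : ℝ[X]) ^ lam - 1) ^ n).coeff m = 0 := by
  rw [← aux_S, Finset.sum_filter]
  refine Finset.sum_eq_zero fun i hi => ?_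
  rw [if_neg]
  intro hp
  rw [Finset.Nat.mem_antidiagonalTuple] at hi
  have : ∑ j : Fin n, 1 ≤ ∑ j, i j := Finset.sum_le_sum fun j _ => hp j
  simp at this
  omega

open Polynomial in
lemma aux_choose (lam k m : ℕ) : ((lam * k).choose m : ℝ) =
    ∑ n ∈ Finset.range (m + 1), (k.choose n : ℝ) * (((1 + X : ℝ[X]) ^ lam - 1) ^ n).coeff m := by
  rw [← coeff_one_add_X_pow, pow_mul]
  conv_lhs => rw [show ((1 + X : ℝ[X]) ^ lam) = ((1 + X : ℝ[X]) ^ lam - 1) + 1 by ring]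
  rw [add_pow, finsetSum_coeff]
  have e : ∀ n, ((((1 + X : ℝ[X]) ^ lam - 1) ^ n) * 1 ^ (k - n) * (k.choose n : ℝ[X])).coeff m
      = (k.choose n : ℝ) * (((1 + X : ℝ[X]) ^ lam - 1) ^ n).coeff m := by
    intro n
    rw [one_pow, mul_one, coeff_mul_natCast, mul_comm]
  simp_rw [e]
  have h1 : ∀ N, m ≤ N → ∑ n ∈ Finset.range (m + 1),
      (k.choose n : ℝ) * (((1 + X : ℝ[X]) ^ lam - 1) ^ n).coeff m =
      ∑ n ∈ Finset.range (N + 1),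
      (k.choose n : ℝ) * (((1 + X : ℝ[X]) ^ lam - 1) ^ n).coeff m := by
    intro N hN
    apply Finset.sum_subset
    · intro a; simp; omega
    · intro a _ ha
      rw [aux_S_zero _ _ _ (by simp at ha; omega), mul_zero]
  have h2 : ∀ N, k ≤ N → ∑ n ∈ Finset.range (k + 1),
      (k.choose n : ℝ) * (((1 + X : ℝ[X]) ^ lam - 1) ^ n).coeff m =
      ∑ n ∈ Finset.range (N + 1),
      (k.choose n : ℝ) * (((1 + X : ℝ[X]) ^ lam - 1) ^ n).coeff m := by
    intro N hN
    apply Finset.sum_subset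
    · intro a; simp; omega
    · intro a _ ha
      rw [Nat.choose_eq_zero_of_lt (by simp at ha; omega), Nat.cast_zero, zero_mul]
  rw [h1 (max m k) (le_max_left _ _), h2 (max m k) (le_max_right _ _)]

open Polynomial in
lemma aux_poly (lam m : ℕ) : (descPochhammer ℝ m).comp (C (lam : ℝ) * X) =
    ∑ n ∈ Finset.range (m + 1),
      ((m.factorial : ℝ) / n.factorial * (((1 + X : ℝ[X]) ^ lam - 1) ^ n).coeff m) •
        descPochhammer ℝ n := by
  apply eq_of_infinite_eval_eq
  apply (Set.infinite_range_of_injective (Nat.cast_injective (R := ℝ))).mono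
  rintro _ ⟨k, rfl⟩
  simp only [Set.mem_ofPred_eq, eval_comp, eval_mul, eval_C, eval_X, eval_finsetSum, eval_smul,
    smul_eq_mul]
  rw [← Nat.cast_mul]
  simp only [descPochhammer_eval_eq_descFactorial, Nat.descFactorial_eq_factorial_mul_choose,
    Nat.cast_mul _ (Nat.choose _ _)]
  rw [aux_choose, Finset.mul_sum]
  refine Finset.sum_congr rfl fun n _ => ?_
  have : (n.factorial : ℝ) ≠ 0 := by positivity
  field_simp

open Polynomial in
/-- umbral functional -/
noncomputable def umbL (x : ℝ) : ℝ[X] →ₗ[ℝ] ℝ :=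
  Polynomial.lsum (fun l => (bernoulliPoly l x) • (LinearMap.id : ℝ →ₗ[ℝ] ℝ))

open Polynomial in
lemma umbL_apply (x : ℝ) (p : ℝ[X]) (N : ℕ) (h : p.natDegree < N) :
    umbL x p = ∑ l ∈ Finset.range N, p.coeff l * bernoulliPoly l x := by
  rw [umbL, lsum_apply, sum_over_range' _ _ N h]
  · simp [mul_comm]
  · simp

open Polynomial in
lemma umbL_X_pow (x : ℝ) (n : ℕ) : umbL x (X ^ n) = bernoulliPoly n x := by
  rw [umbL_apply x _ (n + 1) (by simp)]
  simp [coeff_X_pow]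

open Polynomial in
lemma umbL_diff (x : ℝ) (r : ℝ[X]) :
    umbL x (r.comp (X + 1) - r) = r.derivative.eval x := by
  induction r using Polynomial.induction_on' with
  | add p q hp hq =>
    rw [add_comp, derivative_add, eval_add, ← hp, ← hq, ← map_add]
    congr 1; ring
  | monomial n a =>
    rw [← C_mul_X_pow_eq_monomial, ← smul_eq_C_mul, smul_comp, ← smul_sub, map_smul,
      derivative_smul, eval_smul]
    congr 1
    cases n with
    | zero => simp
    | succ n =>
      rw [pow_comp, X_comp, add_pow, Finset.sum_range_succ]
      have : ∑ k ∈ Finset.range (n + 1), (X : ℝ[X]) ^ k * 1 ^ (n + 1 - k) * ((n + 1).choose k : ℝ[X])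
          + X ^ (n + 1) * 1 ^ (n + 1 - (n + 1)) * ((n + 1).choose (n + 1) : ℝ[X]) - X ^ (n + 1) =
          ∑ k ∈ Finset.range (n + 1), ((n + 1).choose k : ℝ) • (X : ℝ[X]) ^ k := by
        simp only [one_pow, mul_one, Nat.choose_self, Nat.cast_one, add_sub_cancel_right]
        refine Finset.sum_congr rfl fun k _ => ?_
        rw [smul_eq_C_mul, mul_comm]; simp
      rw [this, map_sum]
      simp_rw [map_smul, umbL_X_pow]
      have := congrArg (fun p => aeval x p) (Polynomial.sum_bernoulli n)
      simp only [map_sum, map_smul, aeval_monomial] at this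
      simp only [bernoulliPoly, smul_eq_mul]
      simp [Algebra.smul_def] at this ⊢
      exact this

open Polynomial in
lemma aux_comp (n : ℕ) : (descPochhammer ℝ (n + 1)).comp (X + 1) - descPochhammer ℝ (n + 1) =
    ((n : ℝ) + 1) • descPochhammer ℝ n := by
  have h := congrArg (fun p => p.comp (X + 1)) (descPochhammer_succ_comp_X_sub_one (R := ℝ) n)
  simp only [smul_eq_mul, sub_comp, mul_comp, comp_assoc, X_comp, one_comp, add_sub_cancel_right,
    comp_X, add_comp, natCast_comp] at h
  rw [smul_eq_C_mul]
  simp only [map_add, map_natCast, map_one]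
  linear_combination -h

open Polynomial in
lemma aux_deriv (x : ℝ) (n : ℕ) : (descPochhammer ℝ n).derivative.eval x =
    n.factorial * ∑ m ∈ Finset.range n,
      (-1 : ℝ) ^ (n - 1 - m) / (m.factorial * ((n - m : ℕ) : ℝ)) * fallFac x m := by
  induction n with
  | zero => simp
  | succ n ih =>
    rw [descPochhammer_succ_right, derivative_mul, eval_add, eval_mul, eval_mul, ih]
    simp only [derivative_sub, derivative_X, derivative_natCast, sub_zero, eval_one, mul_one,
      eval_sub, eval_X, eval_natCast]
    rw [descPochhammer_eval_eq_prod_range]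
    change _ + fallFac x n = _
    set f : ℕ → ℝ := fun k => (-1 : ℝ) ^ (n - k) * k / (k.factorial * ((n + 1 - k : ℕ) : ℝ)) * fallFac x k
    have e1 : (∑ m ∈ Finset.range n,
      (-1 : ℝ) ^ (n - 1 - m) / (m.factorial * ((n - m : ℕ) : ℝ)) * fallFac x m) * (x - n) =
      ∑ m ∈ Finset.range n, f (m + 1) +
      ∑ m ∈ Finset.range n, (-1 : ℝ) ^ (n - m) / m.factorial * fallFac x m := by
      rw [Finset.sum_mul, ← Finset.sum_add_distrib]
      refine Finset.sum_congr rfl fun m hm => ?_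
      obtain ⟨d, rfl⟩ := Nat.exists_eq_add_of_lt (Finset.mem_range.1 hm)
      simp only [f]
      have h1 : m + d + 1 - 1 - m = d := by omega
      have h2 : m + d + 1 - m = d + 1 := by omega
      have h3 : m + d + 1 - (m + 1) = d := by omega
      have h4 : m + d + 1 + 1 - (m + 1) = d + 1 := by omega
      have h5 : fallFac x (m + 1) = fallFac x m * (x - m) := by
        simp [fallFac, Finset.prod_range_succ]
      rw [h1, h2, h3, h4, h5, Nat.factorial_succ]
      have : (m.factorial : ℝ) ≠ 0 := by positivity
      push_cast
      field_simp
      ring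
    have e2 : ∑ m ∈ Finset.range n, f (m + 1) = ∑ m ∈ Finset.range (n + 1), f m := by
      rw [Finset.sum_range_succ']
      simp [f]
    have hn : (n.factorial : ℝ) ≠ 0 := by positivity
    have e3 : ∑ m ∈ Finset.range n, (-1 : ℝ) ^ (n - m) / m.factorial * fallFac x m =
        ∑ m ∈ Finset.range (n + 1), (-1 : ℝ) ^ (n - m) / m.factorial * fallFac x m
          - fallFac x n / n.factorial := by
      rw [Finset.sum_range_succ]
      simp
      ring
    rw [mul_assoc, e1, e2, e3, add_sub_assoc', ← Finset.sum_add_distrib, mul_sub,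
      mul_div_cancel₀ _ hn, sub_add_cancel, Nat.factorial_succ]
    push_cast
    rw [mul_comm ((n : ℝ) + 1), mul_assoc, Finset.mul_sum _ _ ((n : ℝ) + 1)]
    congr 1
    refine Finset.sum_congr rfl fun m hm => ?_
    obtain ⟨d, rfl⟩ := Nat.exists_eq_add_of_le (Nat.lt_succ_iff.1 (Finset.mem_range.1 hm))
    simp only [f]
    have h1 : m + d - m = d := by omega
    have h2 : m + d + 1 - m = d + 1 := by omega
    have h3 : m + d + 1 - 1 - m = d := by omega
    rw [h1, h2]
    have : (m.factorial : ℝ) ≠ 0 := by positivity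
    push_cast
    field_simp
    ring

lemma aux_daehee (x : ℝ) (n : ℕ) : umbL x (descPochhammer ℝ n) = daeheePoly n x := by
  have h := umbL_diff x (descPochhammer ℝ (n + 1))
  rw [aux_comp, map_smul, smul_eq_mul, aux_deriv, Nat.factorial_succ] at h
  have hn : (n : ℝ) + 1 ≠ 0 := by positivity
  apply mul_left_cancel₀ hn
  rw [h]
  push_cast
  rw [mul_assoc, daeheePoly]
  congr 1
  rw [Finset.mul_sum]
  refine Finset.sum_congr rfl fun m hm => ?_
  rw [Nat.cast_choose ℝ (Nat.lt_succ_iff.1 (Finset.mem_range.1 hm)), daehee]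
  obtain ⟨d, rfl⟩ := Nat.exists_eq_add_of_le (Nat.lt_succ_iff.1 (Finset.mem_range.1 hm))
  have h1 : m + d - m = d := by omega
  have h2 : m + d + 1 - m = d + 1 := by omega
  have h3 : m + d + 1 - 1 - m = d := by omega
  rw [h1, h2]
  have : (m.factorial : ℝ) ≠ 0 := by positivity
  have : (d.factorial : ℝ) ≠ 0 := by positivity
  push_cast
  field_simp

/-- `D_{m,λ}(λx) = m! ∑_{n=0}^m ∑_{i₁+⋯+iₙ=m, iⱼ ≥ 1} (D_n(x)/n!) C(λ,i₁)⋯C(λ,iₙ)`,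
where `D_{m,λ}(λx) = ∑_{l=0}^m s₁(m,l) λ^l B_l(x)`. -/
theorem lambdaDaeheePoly_eq_sum_over_compositions (lam : ℕ) (hlam : 0 < lam) (m : ℕ) (x : ℝ) :
    (∑ l ∈ Finset.range (m + 1), s1 m l * (lam : ℝ) ^ l * bernoulliPoly l x) =
      (m.factorial : ℝ) *
        ∑ n ∈ Finset.range (m + 1),
          ∑ i ∈ (Finset.Nat.antidiagonalTuple n m).filter (fun i => ∀ j, 0 < i j),
            (daeheePoly n x / (n.factorial : ℝ)) * ∏ j, (lam.choose (i j) : ℝ) := by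
  have h := congrArg (umbL x) (aux_poly lam m)
  rw [umbL_apply x _ (m + 1)] at h
  · simp only [Polynomial.comp_C_mul_X_coeff] at h
    simp only [s1]
    rw [h, map_sum, Finset.mul_sum]
    refine Finset.sum_congr rfl fun n _ => ?_
    rw [← Finset.mul_sum, aux_S, map_smul, aux_daehee, smul_eq_mul]
    ring
  · refine lt_of_le_of_lt Polynomial.natDegree_comp_le ?_
    rw [descPochhammer_natDegree]
    have := Polynomial.natDegree_C_mul_le (lam : ℝ) Polynomial.X
    rw [Polynomial.natDegree_X] at this
    nlinarith
end
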